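/- arXiv:2509.03258 — 3 statements merged into one kernel-verified Lean document; each statement's English description precedes it below -/
import Mathlib

section
/- In the GME model setting, assume condition (C1) (𝔡(x) := f(Ax) − (μ/2)‖B𝔏x‖² is convex on X) and that f∘A is bounded below on X. Then for every x ∈ X with rec(f∘A)(x) = 0, one has rec(J)(x) = μ·rec(Ψ)(𝔏x). -/
open scoped Pointwise RealInnerProductSpace

noncomputable section

/-- Convexity for extended-real-valued functions. -/
def EConvex {H : Type*} [AddCommGroup H] [Module ℝ H] (φ : H → EReal) : Prop :=
  ∀ (x y : H) (a b : ℝ), 0 ≤ a → 0 ≤ b → a + b = 1 →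
    φ (a • x + b • y) ≤ (a : EReal) * φ x + (b : EReal) * φ y

/-- Coercivity (`φ u → ∞` as `‖u‖ → ∞`) for extended-real-valued functions. -/
def ECoercive {H : Type*} [NormedAddCommGroup H] (φ : H → EReal) : Prop :=
  ∀ C : ℝ, ∃ R : ℝ, ∀ x : H, R ≤ ‖x‖ → (C : EReal) ≤ φ x

/-- Generalized Moreau enhanced function `Ψ_B(z) = Ψ(z) − inf_v [Ψ(v) + (1/2)‖B(z−v)‖²]`. -/
noncomputable def GME {Z Z' : Type*} [NormedAddCommGroup Z] [InnerProductSpace ℝ Z]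
    [NormedAddCommGroup Z'] [InnerProductSpace ℝ Z']
    (Ψ : Z → EReal) (B : Z →ₗ[ℝ] Z') (z : Z) : EReal :=
  Ψ z - ⨅ v : Z, (Ψ v + ((((1 : ℝ) / 2) * ‖B (z - v)‖ ^ 2 : ℝ) : EReal))

/-- The cost function `J(x) = f(Ax) + μ Ψ_B(𝔏x)`. -/
noncomputable def Jcost {X Y Z Z' : Type*}
    [NormedAddCommGroup X] [InnerProductSpace ℝ X]
    [NormedAddCommGroup Y] [InnerProductSpace ℝ Y]
    [NormedAddCommGroup Z] [InnerProductSpace ℝ Z]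
    [NormedAddCommGroup Z'] [InnerProductSpace ℝ Z']
    (A : X →ₗ[ℝ] Y) (Lm : X →ₗ[ℝ] Z) (B : Z →ₗ[ℝ] Z')
    (f : Y → ℝ) (Ψ : Z → EReal) (μ : ℝ) (x : X) : EReal :=
  ((f (A x) : ℝ) : EReal) + (μ : EReal) * GME Ψ B (Lm x)

/-- Recession function `rec(φ)(x) = sup_{v ∈ dom φ} (φ(v + x) − φ(v))`. -/
noncomputable def erec {H : Type*} [AddCommGroup H] (φ : H → EReal) (x : H) : EReal :=
  ⨆ v ∈ {v : H | φ v ≠ ⊤}, (φ (v + x) - φ v)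

theorem ECoercive.exists_lower_bound {H : Type*} [NormedAddCommGroup H] [InnerProductSpace ℝ H]
    [FiniteDimensional ℝ H] {φ : H → EReal} (hbot : ∀ z, φ z ≠ ⊥)
    (hlsc : LowerSemicontinuous φ) (hcoer : ECoercive φ) : ∃ c : ℝ, ∀ z, (c : EReal) ≤ φ z := by
  obtain ⟨R, hR⟩ := hcoer 0
  obtain ⟨z₀, hz₀⟩ : ∃ z₀, ∀ z ∈ Metric.closedBall (0 : H) R, φ z₀ ≤ φ z := by
    rcases (Metric.closedBall (0 : H) R).eq_empty_or_nonempty with h | h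
    · exact ⟨0, by simp [h]⟩
    · obtain ⟨a, -, ha⟩ := (hlsc.lowerSemicontinuousOn _).exists_isMinOn h
        (isCompact_closedBall (0 : H) R)
      exact ⟨a, fun z hz => ha hz⟩
  obtain ⟨c, hc⟩ : ∃ c : ℝ, (c : EReal) < φ z₀ := by
    obtain ⟨c, -, hc⟩ := EReal.lt_iff_exists_real_btwn.1 (bot_lt_iff_ne_bot.2 (hbot z₀))
    exact ⟨c, hc⟩
  refine ⟨min c 0, fun z => ?_⟩
  rcases le_total R ‖z‖ with h | h
  · exact le_trans (EReal.coe_le_coe_iff.2 (min_le_right _ _)) (hR z h)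
  · exact (EReal.coe_le_coe_iff.2 (min_le_left _ _)).trans
      (hc.le.trans (hz₀ z (by simpa using h)))

theorem EReal.exists_coe_eq {a : EReal} (hbot : a ≠ ⊥) (htop : a ≠ ⊤) : ∃ r : ℝ, a = r :=
  ⟨a.toReal, (EReal.coe_toReal htop hbot).symm⟩

theorem sub_le_erec {H : Type*} [AddCommGroup H] (φ : H → EReal) (x : H) {v : H}
    (hv : φ v ≠ ⊤) : φ (v + x) - φ v ≤ erec φ x :=
  le_iSup₂ (f := fun v (_ : v ∈ {v : H | φ v ≠ ⊤}) => φ (v + x) - φ v) v hv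

/-- The recession function of a convex lower semicontinuous function is controlled by its
growth along one ray. -/
theorem EConvex.erec_le_of_linear_growth {H : Type*} [NormedAddCommGroup H] [NormedSpace ℝ H]
    {φ : H → EReal} (hconv : EConvex φ) (hbot : ∀ z, φ z ≠ ⊥) (hlsc : LowerSemicontinuous φ)
    {z₀ d : H} {C s : ℝ} (h : ∀ n : ℕ, φ (z₀ + (n : ℝ) • d) ≤ ((C + n * s : ℝ) : EReal)) :
    erec φ d ≤ s := by
  refine iSup₂_le fun z hz => ?_
  obtain ⟨p, hp⟩ := EReal.exists_coe_eq (hbot z) hz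
  rw [hp, EReal.sub_le_iff_le_add (by simp) (by simp), ← EReal.coe_add]
  by_contra! hlt
  obtain ⟨y, hy₁, hy₂⟩ := EReal.lt_iff_exists_real_btwn.1 hlt
  have hε : Filter.Tendsto (fun n : ℕ => (1 / ((n : ℝ) + 1))) Filter.atTop (nhds 0) :=
    tendsto_one_div_add_atTop_nhds_zero_nat
  have hw : Filter.Tendsto (fun n : ℕ => z + d + (1 / ((n : ℝ) + 1)) • (z₀ - z))
      Filter.atTop (nhds (z + d)) := by
    simpa using (hε.smul_const (z₀ - z)).const_add (z + d)
  have hlim : Filter.Tendsto (fun n : ℕ => s + p + (1 / ((n : ℝ) + 1)) * (C - p))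
      Filter.atTop (nhds (s + p)) := by
    simpa using (hε.mul_const (C - p)).const_add (s + p)
  have hle : ∀ᶠ n : ℕ in Filter.atTop, y ≤ s + p + (1 / ((n : ℝ) + 1)) * (C - p) := by
    filter_upwards [hw.eventually (hlsc (z + d) y hy₂)] with n hn
    have hpos : (0 : ℝ) < (n : ℝ) + 1 := by positivity
    have hε0 : 0 ≤ 1 / ((n : ℝ) + 1) := by positivity
    have hε1 : 1 / ((n : ℝ) + 1) ≤ 1 := by
      rw [div_le_one hpos]; linarith [Nat.cast_nonneg (α := ℝ) n]
    have key := hconv z (z₀ + ((n + 1 : ℕ) : ℝ) • d) (1 - 1 / ((n : ℝ) + 1)) (1 / ((n : ℝ) + 1))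
      (by linarith) hε0 (by ring)
    have heq : (1 - 1 / ((n : ℝ) + 1)) • z + (1 / ((n : ℝ) + 1)) • (z₀ + ((n + 1 : ℕ) : ℝ) • d)
        = z + d + (1 / ((n : ℝ) + 1)) • (z₀ - z) := by
      rw [smul_add, smul_smul]
      have : 1 / ((n : ℝ) + 1) * ((n + 1 : ℕ) : ℝ) = 1 := by push_cast; field_simp
      rw [this]
      module
    rw [heq, hp] at key
    have h2 : ((1 / ((n : ℝ) + 1) : ℝ) : EReal) * φ (z₀ + ((n + 1 : ℕ) : ℝ) • d) ≤
        ((1 / ((n : ℝ) + 1) : ℝ) : EReal) * ((C + (n + 1 : ℕ) * s : ℝ) : EReal) :=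
      mul_le_mul_of_nonneg_left (h (n + 1)) (by exact_mod_cast hε0)
    have h3 := (hn.trans_le key).trans_le (add_le_add_right h2 _)
    rw [← EReal.coe_mul, ← EReal.coe_mul, ← EReal.coe_add, EReal.coe_lt_coe_iff] at h3
    refine h3.le.trans (le_of_eq ?_)
    push_cast
    field_simp
    ring
  have := ge_of_tendsto hlim hle
  rw [EReal.coe_lt_coe_iff] at hy₁
  linarith

/-- The differences of `φ` along a ray are controlled by multiples of its recession function. -/
theorem le_add_mul_of_erec_eq {H : Type*} [AddCommGroup H] [Module ℝ H] {φ : H → EReal}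
    {v x : H} {j r : ℝ} (hbot : ∀ z, φ z ≠ ⊥) (hv : φ v = j) (hr : erec φ x = r) (n : ℕ) :
    φ (v + (n : ℝ) • x) ≤ ((j + n * r : ℝ) : EReal) := by
  induction n with
  | zero => simp [hv]
  | succ n ih =>
    have htop : φ (v + (n : ℝ) • x) ≠ ⊤ := ne_top_of_le_ne_top (EReal.coe_ne_top _) ih
    obtain ⟨k, hk⟩ := EReal.exists_coe_eq (hbot _) htop
    have h := sub_le_erec φ x htop
    have heq : v + (n : ℝ) • x + x = v + ((n + 1 : ℕ) : ℝ) • x := by push_cast; module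
    rw [hr, hk, heq, EReal.sub_le_iff_le_add (by simp) (by simp), ← EReal.coe_add] at h
    rw [hk, EReal.coe_le_coe_iff] at ih
    refine h.trans (EReal.coe_le_coe_iff.2 ?_)
    push_cast
    linarith

/-- A function that does not increase along `x` can only stay convex after subtracting a squared
seminorm if this seminorm vanishes at `x`. -/
theorem apply_eq_zero_of_convexOn_sub_sq {X V : Type*} [AddCommGroup X] [Module ℝ X]
    [NormedAddCommGroup V] [NormedSpace ℝ V] {g : X → ℝ} {T : X →ₗ[ℝ] V} {κ : ℝ} (hκ : 0 < κ)
    (hconv : ConvexOn ℝ Set.univ fun x => g x - κ * ‖T x‖ ^ 2) {x : X}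
    (hx : ∀ v, g (v + x) ≤ g v) : T x = 0 := by
  have hg : ∀ n : ℕ, g ((n : ℝ) • x) ≤ g 0 := by
    intro n
    induction n with
    | zero => simp
    | succ n ih =>
      have := hx ((n : ℝ) • x)
      rw [show (n : ℝ) • x + x = ((n + 1 : ℕ) : ℝ) • x by push_cast; module] at this
      exact this.trans ih
  by_contra hne
  have hk : 0 < κ * ‖T x‖ ^ 2 := by positivity
  set k := κ * ‖T x‖ ^ 2 with hk_def
  obtain ⟨n, hn⟩ := exists_nat_gt (max 0 ((g 0 - g x + k) / k))
  have hn0 : (0 : ℝ) < n := (le_max_left _ _).trans_lt hn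
  have hn2 : g 0 - g x + k < n * k := (div_lt_iff₀ hk).1 ((le_max_right _ _).trans_lt hn)
  have hn1 : (1 : ℝ) ≤ n := by exact_mod_cast Nat.one_le_iff_ne_zero.2 (by rintro rfl; simp at hn0)
  have ha : 0 ≤ 1 - 1 / (n : ℝ) := by
    rw [sub_nonneg, div_le_one hn0]
    exact hn1
  have hb : 0 ≤ 1 / (n : ℝ) := by positivity
  have key := hconv.2 (Set.mem_univ (0 : X)) (Set.mem_univ ((n : ℝ) • x)) ha hb (by ring)
  have heq : (1 - 1 / (n : ℝ)) • (0 : X) + (1 / (n : ℝ)) • ((n : ℝ) • x) = x := by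
    rw [smul_zero, zero_add, smul_smul, one_div_mul_cancel hn0.ne', one_smul]
  simp only [heq, map_zero, norm_zero, map_smul, norm_smul, smul_eq_mul, Real.norm_natCast] at key
  have hsq : κ * ((n : ℝ) * ‖T x‖) ^ 2 = n ^ 2 * k := by rw [hk_def]; ring
  rw [hsq, ← hk_def] at key
  have h4 : (1 / (n : ℝ)) * (g ((n : ℝ) • x) - n ^ 2 * k) ≤ 1 / (n : ℝ) * g 0 - n * k := by
    have := mul_le_mul_of_nonneg_left (hg n) (by positivity : (0 : ℝ) ≤ 1 / n)
    have h5 : 1 / (n : ℝ) * (n ^ 2 * k) = n * k := by field_simp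
    rw [mul_sub, h5]
    linarith
  simp only [ne_eq, OfNat.ofNat_ne_zero, not_false_eq_true, zero_pow, mul_zero, sub_zero] at key
  linarith

theorem stmt8
    {X Y Z Z' W : Type*}
    [NormedAddCommGroup X] [InnerProductSpace ℝ X] [FiniteDimensional ℝ X]
    [NormedAddCommGroup Y] [InnerProductSpace ℝ Y] [FiniteDimensional ℝ Y]
    [NormedAddCommGroup Z] [InnerProductSpace ℝ Z] [FiniteDimensional ℝ Z]
    [NormedAddCommGroup Z'] [InnerProductSpace ℝ Z'] [FiniteDimensional ℝ Z']
    [NormedAddCommGroup W] [InnerProductSpace ℝ W] [FiniteDimensional ℝ W]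
    (A : X →ₗ[ℝ] Y) (Lm : X →ₗ[ℝ] Z) (B : Z →ₗ[ℝ] Z') (Cm : X →ₗ[ℝ] W)
    (f : Y → ℝ) (hf : ConvexOn ℝ Set.univ f)
    (Ψ : Z → EReal) (hΨbot : ∀ z : Z, Ψ z ≠ ⊥) (hΨlsc : LowerSemicontinuous Ψ)
    (hΨconv : EConvex Ψ) (hΨcoer : ECoercive Ψ)
    (μ : ℝ) (hμ : 0 < μ)
    (Δ : Set W) (hΔne : Δ.Nonempty) (hΔcl : IsClosed Δ) (hΔcv : Convex ℝ Δ)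
    (hfeas : ∃ x : X, Ψ (Lm x) ≠ ⊤ ∧ Cm x ∈ Δ)
    (hC1 : ConvexOn ℝ Set.univ (fun x : X => f (A x) - μ / 2 * ‖B (Lm x)‖ ^ 2))
    (hbdd : ∃ c : ℝ, ∀ x : X, c ≤ f (A x)) :
    ∀ x : X, erec (fun x' : X => ((f (A x') : ℝ) : EReal)) x = 0 →
      erec (Jcost A Lm B f Ψ μ) x = (μ : EReal) * erec Ψ (Lm x) := by
  intro x hx
  obtain ⟨c, hc⟩ := hbdd
  obtain ⟨x₀, hx₀, -⟩ := hfeas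
  obtain ⟨b, hb⟩ := hΨcoer.exists_lower_bound hΨbot hΨlsc
  have hfx : ∀ v, f (A (v + x)) ≤ f (A v) := by
    intro v
    have h := sub_le_erec (fun x' : X => ((f (A x') : ℝ) : EReal)) x (v := v) (by simp)
    rw [hx, ← EReal.coe_sub] at h
    have h' : f (A (v + x)) - f (A v) ≤ 0 := by exact_mod_cast h
    linarith
  have hBx : B (Lm x) = 0 :=
    apply_eq_zero_of_convexOn_sub_sq (T := B ∘ₗ Lm) (g := fun v => f (A v)) (half_pos hμ) hC1 hfx
  have henv : ∀ z : Z, ∃ m : ℝ,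
      (⨅ v : Z, (Ψ v + ((((1 : ℝ) / 2) * ‖B (z - v)‖ ^ 2 : ℝ) : EReal))) = m := by
    intro z
    refine EReal.exists_coe_eq (ne_bot_of_le_ne_bot (EReal.coe_ne_bot b) ?_)
      (ne_top_of_le_ne_top ?_ (iInf_le _ (Lm x₀)))
    · refine le_iInf fun v => (hb v).trans ?_
      exact le_add_of_nonneg_right (EReal.coe_nonneg.2 (by positivity))
    · exact EReal.add_ne_top hx₀ (EReal.coe_ne_top _)
  choose m hm using henv
  have hJ_top : ∀ v, Ψ (Lm v) = ⊤ → Jcost A Lm B f Ψ μ v = ⊤ := by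
    intro v hv
    rw [Jcost, GME, hm, hv, EReal.top_sub_coe, EReal.coe_mul_top_of_pos hμ, EReal.coe_add_top]
  have hJ_coe : ∀ v (p : ℝ), Ψ (Lm v) = p →
      Jcost A Lm B f Ψ μ v = ((f (A v) + μ * (p - m (Lm v)) : ℝ) : EReal) := by
    intro v p hv
    rw [Jcost, GME, hm, hv]
    push_cast
    rfl
  have hJ_bot : ∀ v, Jcost A Lm B f Ψ μ v ≠ ⊥ := by
    intro v
    by_cases hv : Ψ (Lm v) = ⊤
    · simp [hJ_top v hv]
    · obtain ⟨p, hp⟩ := EReal.exists_coe_eq (hΨbot _) hv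
      rw [hJ_coe v p hp]
      exact EReal.coe_ne_bot _
  have hm_add : ∀ v (n : ℕ), m (Lm (v + (n : ℝ) • x)) = m (Lm v) := by
    intro v n
    rw [← EReal.coe_eq_coe_iff, ← hm, ← hm]
    congr! 5 with w
    simp [hBx]
  have hμ0 : (0 : EReal) ≤ (μ : EReal) := EReal.coe_nonneg.2 hμ.le
  apply le_antisymm
  · refine iSup₂_le fun v hv => ?_
    have hv' : Ψ (Lm v) ≠ ⊤ := fun h => hv (hJ_top v h)
    obtain ⟨p, hp⟩ := EReal.exists_coe_eq (hΨbot _) hv'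
    have hΨ := mul_le_mul_of_nonneg_left (sub_le_erec Ψ (Lm x) hv') hμ0
    refine le_trans ?_ hΨ
    rw [← map_add]
    by_cases hq : Ψ (Lm (v + x)) = ⊤
    · rw [hq, hp, EReal.top_sub_coe, EReal.coe_mul_top_of_pos hμ]
      exact le_top
    · obtain ⟨q, hq⟩ := EReal.exists_coe_eq (hΨbot _) hq
      have hmx : m (Lm (v + x)) = m (Lm v) := by simpa using hm_add v 1
      rw [hJ_coe v p hp, hJ_coe _ q hq, hp, hq, hmx, ← EReal.coe_sub, ← EReal.coe_sub,
        ← EReal.coe_mul, EReal.coe_le_coe_iff]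
      linarith [hfx v]
  · obtain ⟨p, hp⟩ := EReal.exists_coe_eq (hΨbot _) hx₀
    have hj := hJ_coe x₀ p hp
    by_cases htop : erec (Jcost A Lm B f Ψ μ) x = ⊤
    · rw [htop]
      exact le_top
    have hbot : erec (Jcost A Lm B f Ψ μ) x ≠ ⊥ := by
      refine ne_bot_of_le_ne_bot ?_
        (sub_le_erec (Jcost A Lm B f Ψ μ) x (v := x₀) (by rw [hj]; exact EReal.coe_ne_top _))
      rw [hj, sub_eq_add_neg, ← EReal.coe_neg]
      exact EReal.add_ne_bot_iff.2 ⟨hJ_bot _, EReal.coe_ne_bot _⟩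
    obtain ⟨r, hr⟩ := EReal.exists_coe_eq hbot htop
    have hgrowth : ∀ n : ℕ, Ψ (Lm x₀ + (n : ℝ) • Lm x) ≤
        (((f (A x₀) - c) / μ + p + n * (r / μ) : ℝ) : EReal) := by
      intro n
      have h := le_add_mul_of_erec_eq hJ_bot hj hr n
      rw [← map_smul, ← map_add]
      have hq : Ψ (Lm (x₀ + (n : ℝ) • x)) ≠ ⊤ := fun hq => by
        rw [hJ_top _ hq] at h
        exact EReal.coe_ne_top _ (top_le_iff.1 h)
      obtain ⟨q, hq⟩ := EReal.exists_coe_eq (hΨbot _) hq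
      rw [hJ_coe _ q hq, hm_add, EReal.coe_le_coe_iff] at h
      rw [hq, EReal.coe_le_coe_iff]
      have h1 : μ * q ≤ f (A x₀) - c + μ * p + n * r := by linarith [hc (x₀ + (n : ℝ) • x)]
      have h2 : (f (A x₀) - c) / μ + p + n * (r / μ) = (f (A x₀) - c + μ * p + n * r) / μ := by
        field_simp
      rw [h2, le_div_iff₀ hμ]
      linarith
    have h := mul_le_mul_of_nonneg_left
      (hΨconv.erec_le_of_linear_growth hΨbot hΨlsc hgrowth) hμ0
    rwa [← EReal.coe_mul, mul_div_cancel₀ _ hμ.ne', ← hr] at h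
end
end

section
/- In the GME model setting, assume condition (C1) (𝔡(x) := f(Ax) − (μ/2)‖B𝔏x‖² is convex on X) and that f is coercive. Then rec(J)(x) ≥ 0 for every x ∈ X, and rec(J)(x) = 0 if and only if Ax = 0 and 𝔏x = 0. -/
open scoped Pointwise RealInnerProductSpace

noncomputable section

/-- Coercivity for real-valued functions. -/
def RCoercive {H : Type*} [NormedAddCommGroup H] (φ : H → ℝ) : Prop :=
  ∀ C : ℝ, ∃ R : ℝ, ∀ x : H, R ≤ ‖x‖ → C ≤ φ x

theorem exists_real_lower_bound {H : Type*} [NormedAddCommGroup H] [ProperSpace H]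
    {φ : H → EReal} (hbot : ∀ z, φ z ≠ ⊥) (hlsc : LowerSemicontinuous φ)
    (hcoer : ECoercive φ) : ∃ m : ℝ, ∀ z, (m : EReal) ≤ φ z := by
  obtain ⟨R, hR⟩ := hcoer 0
  obtain ⟨a, -, ha⟩ := (hlsc.lowerSemicontinuousOn (Metric.closedBall 0 |R|)).exists_isMinOn
    ⟨0, Metric.mem_closedBall_self (abs_nonneg R)⟩ (isCompact_closedBall 0 |R|)
  obtain ⟨m, hm0, hma⟩ : ∃ m : ℝ, m ≤ 0 ∧ (m : EReal) ≤ φ a := by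
    induction h : φ a with
    | bot => exact absurd h (hbot a)
    | top => exact ⟨0, le_rfl, le_top⟩
    | coe r => exact ⟨min r 0, min_le_right _ _, by exact_mod_cast min_le_left r 0⟩
  refine ⟨m, fun z => ?_⟩
  rcases le_or_gt R ‖z‖ with hz | hz
  · exact le_trans (by exact_mod_cast hm0) (hR z hz)
  · exact hma.trans (ha (by simpa using hz.le.trans (le_abs_self R)))

theorem le_add_of_erec_le {H : Type*} [AddCommGroup H] [Module ℝ H] {φ : H → EReal}
    (hbot : ∀ z, φ z ≠ ⊥) {x : H} {r : ℝ} (hr : erec φ x ≤ r) {v : H} (hv : φ v ≠ ⊤)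
    (n : ℕ) : φ (v + (n : ℝ) • x) ≤ φ v + ((n * r : ℝ) : EReal) := by
  have step : ∀ w, φ w ≠ ⊤ → φ (w + x) ≤ φ w + (r : EReal) := by
    intro w hw
    have h : φ (w + x) - φ w ≤ r :=
      (le_iSup₂ (f := fun v (_ : v ∈ {v : H | φ v ≠ ⊤}) => φ (v + x) - φ v) w hw).trans hr
    rw [EReal.sub_le_iff_le_add (Or.inl (hbot w)) (Or.inl hw)] at h
    rwa [add_comm (r : EReal)] at h
  induction n with
  | zero => simp
  | succ k ih =>
    have htop : φ (v + (k : ℝ) • x) ≠ ⊤ :=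
      (ih.trans_lt (EReal.add_lt_top hv (EReal.coe_ne_top _))).ne
    have e : v + ((k + 1 : ℕ) : ℝ) • x = v + (k : ℝ) • x + x := by
      push_cast; rw [add_smul, one_smul, add_assoc]
    rw [e]
    refine (step _ htop).trans ((add_le_add_left ih _).trans_eq ?_)
    rw [add_assoc, ← EReal.coe_add]
    congr 2
    push_cast; ring

theorem norm_add_natCast_smul_ge {H : Type*} [NormedAddCommGroup H] [NormedSpace ℝ H]
    (a : H) {b : H} (hb : b ≠ 0) (R : ℝ) : ∃ n : ℕ, R ≤ ‖a + (n : ℝ) • b‖ := by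
  obtain ⟨n, hn⟩ := exists_nat_ge ((R + ‖a‖) / ‖b‖)
  refine ⟨n, ?_⟩
  rw [div_le_iff₀ (norm_pos_iff.2 hb)] at hn
  have h := norm_sub_norm_le ((n : ℝ) • b) (-a)
  rw [norm_smul, norm_neg, sub_neg_eq_add, add_comm _ a] at h
  simp only [Real.norm_natCast] at h
  linarith

section GME

variable {Z Z' : Type*} [NormedAddCommGroup Z] [InnerProductSpace ℝ Z]
  [NormedAddCommGroup Z'] [InnerProductSpace ℝ Z'] {Ψ : Z → EReal}

theorem moreauEnvelope_le (Ψ : Z → EReal) (B : Z →ₗ[ℝ] Z') (z v : Z) :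
    ⨅ v : Z, (Ψ v + ((((1 : ℝ) / 2) * ‖B (z - v)‖ ^ 2 : ℝ) : EReal)) ≤
      Ψ v + ((((1 : ℝ) / 2) * ‖B (z - v)‖ ^ 2 : ℝ) : EReal) :=
  iInf_le _ v

theorem le_moreauEnvelope {m : ℝ} (hm : ∀ z, (m : EReal) ≤ Ψ z) (B : Z →ₗ[ℝ] Z') (z : Z) :
    (m : EReal) ≤ ⨅ v : Z, (Ψ v + ((((1 : ℝ) / 2) * ‖B (z - v)‖ ^ 2 : ℝ) : EReal)) :=
  le_iInf fun v => (hm v).trans (le_add_of_nonneg_right (by exact_mod_cast (by positivity)))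

theorem moreauEnvelope_ne_top {z₀ : Z} (h₀ : Ψ z₀ ≠ ⊤) (B : Z →ₗ[ℝ] Z') (z : Z) :
    ⨅ v : Z, (Ψ v + ((((1 : ℝ) / 2) * ‖B (z - v)‖ ^ 2 : ℝ) : EReal)) ≠ ⊤ :=
  ((moreauEnvelope_le Ψ B z z₀).trans_lt (EReal.add_lt_top h₀ (EReal.coe_ne_top _))).ne

theorem GME_nonneg (hbot : ∀ z, Ψ z ≠ ⊥) {z₀ : Z} (h₀ : Ψ z₀ ≠ ⊤) (B : Z →ₗ[ℝ] Z') (z : Z) :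
    0 ≤ GME Ψ B z := by
  rw [GME, EReal.sub_nonneg (Or.inr (moreauEnvelope_ne_top h₀ B z)) (Or.inl (hbot z))]
  simpa using moreauEnvelope_le Ψ B z z

theorem GME_ne_top {m : ℝ} (hm : ∀ z, (m : EReal) ≤ Ψ z) (B : Z →ₗ[ℝ] Z') {z : Z}
    (hz : Ψ z ≠ ⊤) : GME Ψ B z ≠ ⊤ := by
  have h := ((EReal.bot_lt_coe m).trans_le (le_moreauEnvelope hm B z)).ne'
  rw [GME, sub_eq_add_neg]
  exact (EReal.add_lt_top hz (by simpa [EReal.neg_eq_top_iff] using h)).ne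

theorem GME_add_of_mem_ker {B : Z →ₗ[ℝ] Z'} (z : Z) {w : Z} (hw : B w = 0) :
    GME Ψ B (z + w) =
      Ψ (z + w) - ⨅ v : Z, (Ψ v + ((((1 : ℝ) / 2) * ‖B (z - v)‖ ^ 2 : ℝ) : EReal)) := by
  simp [GME, hw]

end GME

theorem stmt9
    {X Y Z Z' W : Type*}
    [NormedAddCommGroup X] [InnerProductSpace ℝ X] [FiniteDimensional ℝ X]
    [NormedAddCommGroup Y] [InnerProductSpace ℝ Y] [FiniteDimensional ℝ Y]
    [NormedAddCommGroup Z] [InnerProductSpace ℝ Z] [FiniteDimensional ℝ Z]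
    [NormedAddCommGroup Z'] [InnerProductSpace ℝ Z'] [FiniteDimensional ℝ Z']
    [NormedAddCommGroup W] [InnerProductSpace ℝ W] [FiniteDimensional ℝ W]
    (A : X →ₗ[ℝ] Y) (Lm : X →ₗ[ℝ] Z) (B : Z →ₗ[ℝ] Z') (Cm : X →ₗ[ℝ] W)
    (f : Y → ℝ) (hf : ConvexOn ℝ Set.univ f)
    (Ψ : Z → EReal) (hΨbot : ∀ z : Z, Ψ z ≠ ⊥) (hΨlsc : LowerSemicontinuous Ψ)
    (hΨconv : EConvex Ψ) (hΨcoer : ECoercive Ψ)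
    (μ : ℝ) (hμ : 0 < μ)
    (Δ : Set W) (hΔne : Δ.Nonempty) (hΔcl : IsClosed Δ) (hΔcv : Convex ℝ Δ)
    (hfeas : ∃ x : X, Ψ (Lm x) ≠ ⊤ ∧ Cm x ∈ Δ)
    (hC1 : ConvexOn ℝ Set.univ (fun x : X => f (A x) - μ / 2 * ‖B (Lm x)‖ ^ 2))
    (hfcoer : RCoercive f) :
    (∀ x : X, (0 : EReal) ≤ erec (Jcost A Lm B f Ψ μ) x) ∧
    (∀ x : X, erec (Jcost A Lm B f Ψ μ) x = 0 ↔ A x = 0 ∧ Lm x = 0) := by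
  obtain ⟨x₀, hx₀, -⟩ := hfeas
  obtain ⟨m, hm⟩ := exists_real_lower_bound hΨbot hΨlsc hΨcoer
  have hfcont : Continuous f := by
    have := hf.continuousOn isOpen_univ
    rwa [← continuousOn_univ]
  obtain ⟨c, hc⟩ : ∃ c : ℝ, ∀ y, (c : EReal) ≤ (f y : EReal) :=
    exists_real_lower_bound (fun _ => EReal.coe_ne_bot _)
      (continuous_coe_real_ereal.comp hfcont).lowerSemicontinuous
      (fun C => (hfcoer C).imp fun R hR y hy => by exact_mod_cast hR y hy)
  have hJf : ∀ x, (f (A x) : EReal) ≤ Jcost A Lm B f Ψ μ x := fun x =>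
    le_add_of_nonneg_right
      (mul_nonneg (by exact_mod_cast hμ.le) (GME_nonneg hΨbot hx₀ B (Lm x)))
  have hJbot : ∀ x, Jcost A Lm B f Ψ μ x ≠ ⊥ := fun x =>
    ((EReal.bot_lt_coe _).trans_le (hJf x)).ne'
  have hG₀ := GME_ne_top hm B hx₀
  have hJ₀ : Jcost A Lm B f Ψ μ x₀ ≠ ⊤ := by
    lift GME Ψ B (Lm x₀) to ℝ using
      ⟨hG₀, (EReal.bot_lt_zero.trans_le (GME_nonneg hΨbot hx₀ B _)).ne'⟩ with g hg
    rw [Jcost, ← hg, ← EReal.coe_mul, ← EReal.coe_add]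
    exact EReal.coe_ne_top _
  obtain ⟨j, hj⟩ : ∃ j : ℝ, (j : EReal) = Jcost A Lm B f Ψ μ x₀ :=
    ⟨_, EReal.coe_toReal hJ₀ (hJbot x₀)⟩
  refine ⟨fun x => ?_, fun x => ⟨fun hx => ?_, fun ⟨hA, hL⟩ => ?_⟩⟩
  · by_contra! hneg
    obtain ⟨r, hr, hr0⟩ := EReal.lt_iff_exists_real_btwn.1 hneg
    have hr0 : r < 0 := by exact_mod_cast hr0
    obtain ⟨n, hn⟩ := exists_nat_gt ((j - c) / (-r))
    rw [div_lt_iff₀ (by linarith)] at hn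
    have h := ((hc _).trans (hJf _)).trans (le_add_of_erec_le hJbot hr.le hJ₀ n)
    rw [← hj] at h
    have h : c ≤ j + n * r := by exact_mod_cast h
    linarith
  · have hbd : ∀ n : ℕ, Jcost A Lm B f Ψ μ (x₀ + (n : ℝ) • x) ≤ j := fun n => by
      have h := le_add_of_erec_le hJbot (x := x) (r := 0) (by simp [hx]) hJ₀ n
      rw [hj]
      simpa using h
    have hA : A x = 0 := by
      by_contra hA
      obtain ⟨R, hR⟩ := hfcoer (j + 1)
      obtain ⟨n, hn⟩ := norm_add_natCast_smul_ge (A x₀) hA R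
      have h1 := hR _ hn
      have h2 := (hJf _).trans (hbd n)
      rw [map_add, map_smul] at h2
      have h2 : f (A x₀ + (n : ℝ) • A x) ≤ j := by exact_mod_cast h2
      linarith
    have hB : B (Lm x) = 0 := by
      have h := hC1.2 (Set.mem_univ x) (Set.mem_univ (-x)) (one_half_pos (α := ℝ)).le
        (one_half_pos (α := ℝ)).le (add_halves 1)
      simp only [smul_neg, add_neg_cancel, map_zero, map_neg, hA, norm_neg, norm_zero,
        smul_eq_mul, neg_zero] at h
      have h' : ‖B (Lm x)‖ ^ 2 ≤ 0 := by
        by_contra! hp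
        nlinarith [mul_pos hμ hp]
      simpa using le_antisymm h' (sq_nonneg _)
    refine ⟨hA, ?_⟩
    by_contra hL
    obtain ⟨e, he⟩ : ∃ e : ℝ, (e : EReal) = ⨅ v : Z,
        (Ψ v + ((((1 : ℝ) / 2) * ‖B (Lm x₀ - v)‖ ^ 2 : ℝ) : EReal)) :=
      ⟨_, EReal.coe_toReal (moreauEnvelope_ne_top hx₀ B _)
        ((EReal.bot_lt_coe m).trans_le (le_moreauEnvelope hm B _)).ne'⟩
    obtain ⟨R, hR⟩ := hΨcoer ((j - f (A x₀)) / μ + e + 1)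
    obtain ⟨n, hn⟩ := norm_add_natCast_smul_ge (Lm x₀) hL R
    have h1 := hR _ hn
    have h2 := hbd n
    rw [Jcost, map_add, map_add, map_smul, map_smul, hA, smul_zero, add_zero,
      GME_add_of_mem_ker _ (by rw [map_smul, hB, smul_zero]), ← he] at h2
    have h3 : (f (A x₀) : EReal) + μ * (((j - f (A x₀)) / μ + e + 1 : ℝ) - (e : EReal)) ≤ j :=
      le_trans (add_le_add_right (mul_le_mul_of_nonneg_left
        (EReal.sub_le_sub h1 le_rfl) (by exact_mod_cast hμ.le)) _) h2
    have h3 : f (A x₀) + μ * (((j - f (A x₀)) / μ + e + 1) - e) ≤ j := by exact_mod_cast h3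
    have h4 : μ * (((j - f (A x₀)) / μ + e + 1) - e) = j - f (A x₀) + μ := by
      field_simp; ring
    linarith
  · have hJ : ∀ v, Jcost A Lm B f Ψ μ (v + x) = Jcost A Lm B f Ψ μ v := fun v => by
      simp [Jcost, hA, hL]
    refine le_antisymm (iSup₂_le fun v hv => ?_) ?_
    · rw [hJ, EReal.sub_self hv (hJbot v)]
    · refine le_iSup₂_of_le x₀ hJ₀ ?_
      rw [hJ, EReal.sub_self hJ₀ (hJbot x₀)]
end
end

section
/- In the GME model setting, assume: condition (C1) (𝔡(x) := f(Ax) − (μ/2)‖B𝔏x‖² is convex on X); f is differentiable on Y with Lipschitz continuous gradient; and the subdifferential calculus rules ∂(J + ι_Δ∘ℭ) = ∂J + ∂(ι_Δ∘ℭ), ∂(Ψ∘𝔏) = 𝔏*∘(∂Ψ)∘𝔏, and ∂(ι_Δ∘ℭ) = ℭ*∘(∂ι_Δ)∘ℭ hold. Then x* ∈ X minimizes J over {x : ℭx ∈ Δ} if and only if there exist (v*, w*, z*) ∈ Z × Z × 𝔷 such that: 0 = ∇𝔡(x*) + μ𝔏*B*Bv* + μ𝔏*w* + μℭ*z*; B*B𝔏x*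 ∈ ∂Ψ(v*) + B*Bv*; w* ∈ ∂Ψ(𝔏x*); and z* ∈ ∂ι_Δ(ℭx*). -/
open scoped Pointwise RealInnerProductSpace

noncomputable section

/-- Subdifferential of an extended-real-valued function. -/
def esubdiff {H : Type*} [NormedAddCommGroup H] [InnerProductSpace ℝ H]
    (φ : H → EReal) (x : H) : Set H :=
  {u : H | ∀ y : H, φ x + ((⟪y - x, u⟫ : ℝ) : EReal) ≤ φ y}

-- Indicator function `ι_Δ` of a set (0 on Δ, ∞ outside).
open Classical in
noncomputable def eindicator {W : Type*} (Δ : Set W) (p : W) : EReal :=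
  if p ∈ Δ then 0 else ⊤

/-- First-order optimality: if `x` minimizes `φ + s • K - ⟪·, u⟫` up to a quadratic slack, where `φ`
is convex and `K` has gradient `g` at `x`, then `u - s • g` is a subgradient of `φ` at `x`. -/
theorem sub_smul_mem_esubdiff {H E : Type*}
    [NormedAddCommGroup H] [InnerProductSpace ℝ H] [CompleteSpace H]
    [NormedAddCommGroup E] [InnerProductSpace ℝ E]
    {φ : H → EReal} (hbot : ∀ y, φ y ≠ ⊥) (hconv : EConvex φ)
    {K : H → ℝ} {x g u : H} (hK : HasGradientAt K g x) {s c a : ℝ} {M : H →ₗ[ℝ] E}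
    (ha : φ x = a)
    (hmin : ∀ (y : H) (b : ℝ), φ y = b →
      a + ⟪y - x, u⟫ ≤ b + s * (K y - K x) + c * ‖M (y - x)‖ ^ 2) :
    u - s • g ∈ esubdiff φ x := by
  intro y
  rcases eq_or_ne (φ y) ⊤ with hy | hy
  · rw [hy]; exact le_top
  obtain ⟨b, hb⟩ : ∃ b : ℝ, φ y = b := ⟨_, (EReal.coe_toReal hy (hbot y)).symm⟩
  have key : ∀ t : ℝ, 0 < t → t < 1 →
      a - b + ⟪y - x, u⟫ ≤ s * (t⁻¹ * (K (x + t • (y - x)) - K x)) + t * (c * ‖M (y - x)‖ ^ 2) := by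
    intro t ht ht1
    have hcomb : (1 - t) • x + t • y = x + t • (y - x) := by module
    have h := hconv x y (1 - t) t (by linarith) ht.le (by ring)
    rw [hcomb, ha, hb, ← EReal.coe_mul, ← EReal.coe_mul, ← EReal.coe_add] at h
    have hfin : φ (x + t • (y - x)) ≠ ⊤ := fun h' => by
      rw [h'] at h; exact EReal.coe_ne_top _ (top_le_iff.1 h)
    have hc := (EReal.coe_toReal hfin (hbot _)).symm
    have hm := hmin _ _ hc
    rw [hc, EReal.coe_le_coe_iff] at h
    rw [add_sub_cancel_left, map_smul, norm_smul, inner_smul_left, mul_pow, Real.norm_eq_abs,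
      sq_abs] at hm
    simp only [conj_trivial] at hm
    have hmul : t * (a - b + ⟪y - x, u⟫) ≤ t * (s * (t⁻¹ * (K (x + t • (y - x)) - K x)) +
        t * (c * ‖M (y - x)‖ ^ 2)) := by
      have : t * (s * (t⁻¹ * (K (x + t • (y - x)) - K x)) + t * (c * ‖M (y - x)‖ ^ 2))
          = s * (K (x + t • (y - x)) - K x) + c * (t ^ 2 * ‖M (y - x)‖ ^ 2) := by
        field_simp
      rw [this]
      linarith
    exact le_of_mul_le_mul_left hmul ht
  have hlim : Filter.Tendsto (fun t : ℝ => t⁻¹ * (K (x + t • (y - x)) - K x))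
      (nhdsWithin 0 (Set.Ioi 0)) (nhds ⟪g, y - x⟫) := by
    have h := hK.hasFDerivAt.hasLineDerivAt (y - x)
    have h' := h.tendsto_slope_zero_right
    simpa using h'
  have hid : Filter.Tendsto (fun t : ℝ => t * (c * ‖M (y - x)‖ ^ 2))
      (nhdsWithin 0 (Set.Ioi 0)) (nhds 0) := by
    have : Continuous fun t : ℝ => t * (c * ‖M (y - x)‖ ^ 2) := by fun_prop
    simpa using (this.tendsto 0).mono_left nhdsWithin_le_nhds
  have hle := ge_of_tendsto ((hlim.const_mul s).add hid) (by
    filter_upwards [Ioo_mem_nhdsGT (zero_lt_one' ℝ)] with t ht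
    exact key t ht.1 ht.2)
  rw [ha, hb, ← EReal.coe_add, EReal.coe_le_coe_iff, inner_sub_right, inner_smul_right]
  rw [real_inner_comm (y - x) g] at hle
  linarith

theorem ConvexOn.gradient_mem_esubdiff {H : Type*}
    [NormedAddCommGroup H] [InnerProductSpace ℝ H] [CompleteSpace H]
    {K : H → ℝ} (hconv : ConvexOn ℝ Set.univ K) {x g : H} (hK : HasGradientAt K g x) :
    g ∈ esubdiff (fun y => (K y : EReal)) x := by
  have h := sub_smul_mem_esubdiff (φ := fun y => (K y : EReal)) (u := 0) (s := -1) (c := 0)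
    (M := (0 : H →ₗ[ℝ] H)) (fun _ => EReal.coe_ne_bot _)
    (fun y z a b ha hb hab => by
      rw [← EReal.coe_mul, ← EReal.coe_mul, ← EReal.coe_add, EReal.coe_le_coe_iff]
      exact hconv.2 (Set.mem_univ y) (Set.mem_univ z) ha hb hab) hK rfl
    (fun y b hb => by
      rw [EReal.coe_eq_coe_iff] at hb
      simp [hb])
  simpa using h

theorem EConvex.comp_linearMap {H E : Type*} [AddCommGroup H] [Module ℝ H] [AddCommGroup E]
    [Module ℝ E] {φ : E → EReal} (hφ : EConvex φ) (M : H →ₗ[ℝ] E) :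
    EConvex fun x => φ (M x) := by
  intro x y a b ha hb hab
  simpa using hφ (M x) (M y) a b ha hb hab

theorem ne_top_of_mem_esubdiff {H : Type*} [NormedAddCommGroup H] [InnerProductSpace ℝ H]
    {φ : H → EReal} {x u y : H} (hu : u ∈ esubdiff φ x) (hy : φ y ≠ ⊤) : φ x ≠ ⊤ := fun h => by
  have := hu y
  rw [h, EReal.top_add_coe] at this
  exact hy (top_le_iff.1 this)

theorem mem_esubdiff_eindicator_iff {W : Type*} [NormedAddCommGroup W] [InnerProductSpace ℝ W]
    {Δ : Set W} (hΔ : Δ.Nonempty) {p z : W} :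
    z ∈ esubdiff (eindicator Δ) p ↔ p ∈ Δ ∧ ∀ q ∈ Δ, ⟪q - p, z⟫ ≤ 0 := by
  constructor
  · intro h
    obtain ⟨q₀, hq₀⟩ := hΔ
    have hp : p ∈ Δ := by
      by_contra hp
      exact ne_top_of_mem_esubdiff (y := q₀) h (by simp [eindicator, hq₀]) (by simp [eindicator, hp])
    refine ⟨hp, fun q hq => ?_⟩
    have := h q
    simpa [eindicator, hp, hq] using this
  · rintro ⟨hp, h⟩ q
    by_cases hq : q ∈ Δ
    · simpa [eindicator, hp, hq] using h q hq
    · simp [eindicator, hq]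

theorem exists_forall_envelope_le
    {Z Z' : Type*}
    [NormedAddCommGroup Z] [InnerProductSpace ℝ Z] [FiniteDimensional ℝ Z]
    [NormedAddCommGroup Z'] [InnerProductSpace ℝ Z']
    {Ψ : Z → EReal} {B : Z →ₗ[ℝ] Z'}
    (hbot : ∀ z, Ψ z ≠ ⊥) (hlsc : LowerSemicontinuous Ψ)
    (hcoer : ECoercive Ψ) {v₀ : Z} (hv₀ : Ψ v₀ ≠ ⊤) (z : Z) :
    ∃ v : Z, ∀ v' : Z, Ψ v + ((1 / 2 * ‖B (z - v)‖ ^ 2 : ℝ) : EReal)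
      ≤ Ψ v' + ((1 / 2 * ‖B (z - v')‖ ^ 2 : ℝ) : EReal) := by
  obtain ⟨c, hc⟩ : ∃ c : ℝ, Ψ v₀ = c := ⟨_, (EReal.coe_toReal hv₀ (hbot v₀)).symm⟩
  obtain ⟨R, hR⟩ := hcoer (c + 1 / 2 * ‖B (z - v₀)‖ ^ 2)
  have hcont : Continuous fun v : Z => ((1 / 2 * ‖B (z - v)‖ ^ 2 : ℝ) : EReal) := by
    have := B.continuous_of_finiteDimensional
    exact continuous_coe_real_ereal.comp (by fun_prop)
  have hl : LowerSemicontinuous fun v : Z => Ψ v + ((1 / 2 * ‖B (z - v)‖ ^ 2 : ℝ) : EReal) :=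
    hlsc.add' hcont.lowerSemicontinuous fun v =>
      EReal.continuousAt_add (Or.inr (EReal.coe_ne_bot _)) (Or.inr (EReal.coe_ne_top _))
  have hmem : v₀ ∈ Metric.closedBall (0 : Z) (max R ‖v₀‖) := by simp
  obtain ⟨v, -, hv⟩ := (hl.lowerSemicontinuousOn _).exists_isMinOn ⟨v₀, hmem⟩
    (isCompact_closedBall (0 : Z) (max R ‖v₀‖))
  refine ⟨v, fun v' => ?_⟩
  by_cases hv' : v' ∈ Metric.closedBall (0 : Z) (max R ‖v₀‖)
  · exact hv hv'
  · have hnorm : R ≤ ‖v'‖ := by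
      rw [mem_closedBall_zero_iff, not_le] at hv'
      exact (le_max_left _ _).trans hv'.le
    refine (hv hmem).trans ?_
    simp only
    rw [hc, ← EReal.coe_add]
    refine (hR v' hnorm).trans ?_
    refine le_add_of_nonneg_right ?_
    exact_mod_cast (by positivity : (0 : ℝ) ≤ 1 / 2 * ‖B (z - v')‖ ^ 2)

/-- Every point has a proximal point `v`, characterized by the inclusion of the optimality system. -/
theorem exists_proximal_point
    {Z Z' : Type*}
    [NormedAddCommGroup Z] [InnerProductSpace ℝ Z] [FiniteDimensional ℝ Z]
    [NormedAddCommGroup Z'] [InnerProductSpace ℝ Z'] [FiniteDimensional ℝ Z']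
    {Ψ : Z → EReal} {B : Z →ₗ[ℝ] Z'}
    (hbot : ∀ z, Ψ z ≠ ⊥) (hlsc : LowerSemicontinuous Ψ)
    (hconv : EConvex Ψ) (hcoer : ECoercive Ψ) {v₀ : Z} (hv₀ : Ψ v₀ ≠ ⊤) (z : Z) :
    ∃ v : Z, LinearMap.adjoint B (B (z - v)) ∈ esubdiff Ψ v := by
  obtain ⟨v, hv⟩ := exists_forall_envelope_le (B := B) hbot hlsc hcoer hv₀ z
  have hvt : Ψ v ≠ ⊤ := fun h => by
    have := hv v₀
    rw [h, EReal.top_add_coe, top_le_iff] at this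
    exact EReal.add_ne_top hv₀ (EReal.coe_ne_top _) this
  have ha := (EReal.coe_toReal hvt (hbot v)).symm
  refine ⟨v, ?_⟩
  have h := sub_smul_mem_esubdiff (K := fun _ => (0 : ℝ)) (g := 0)
    (u := LinearMap.adjoint B (B (z - v))) (s := 0) (c := 1 / 2) (M := B) hbot hconv
    (hasGradientAt_const v 0) ha (fun y b hb => by
      have hy := hv y
      rw [ha, hb, ← EReal.coe_add, ← EReal.coe_add, EReal.coe_le_coe_iff] at hy
      have hzy : B (z - y) = B (z - v) - B (y - v) := by rw [← map_sub]; congr 1; abel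
      rw [hzy, norm_sub_sq_real] at hy
      rw [LinearMap.adjoint_inner_right, real_inner_comm]
      linarith)
  simpa using h

/-- The Moreau envelope is attained at a proximal point `v` and lies above its linearization. -/
theorem envelope_tangent_le
    {Z Z' : Type*}
    [NormedAddCommGroup Z] [InnerProductSpace ℝ Z] [FiniteDimensional ℝ Z]
    [NormedAddCommGroup Z'] [InnerProductSpace ℝ Z'] [FiniteDimensional ℝ Z']
    {Ψ : Z → EReal} {B : Z →ₗ[ℝ] Z'}
    {v z : Z} (hv : LinearMap.adjoint B (B (z - v)) ∈ esubdiff Ψ v)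
    {a : ℝ} (ha : Ψ v = a) (z' : Z) :
    ((a + 1 / 2 * ‖B (z - v)‖ ^ 2 + ⟪B (z' - z), B (z - v)⟫ : ℝ) : EReal)
      ≤ ⨅ v' : Z, (Ψ v' + ((1 / 2 * ‖B (z' - v')‖ ^ 2 : ℝ) : EReal)) := by
  refine le_iInf fun v' => ?_
  refine le_trans ?_ (add_le_add_left (hv v') _)
  rw [ha, ← EReal.coe_add, ← EReal.coe_add, EReal.coe_le_coe_iff, LinearMap.adjoint_inner_right]
  have h1 : B (z' - z) = (B (z' - v') - B (z - v)) + B (v' - v) := by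
    rw [← map_sub, ← map_add]; congr 1; abel
  have h2 := norm_sub_sq_real (B (z' - v')) (B (z - v))
  have h3 := sq_nonneg ‖B (z' - v') - B (z - v)‖
  rw [h1, inner_add_left, inner_sub_left, real_inner_self_eq_norm_sq]
  linarith

theorem envelope_le
    {Z Z' : Type*}
    [NormedAddCommGroup Z] [InnerProductSpace ℝ Z]
    [NormedAddCommGroup Z'] [InnerProductSpace ℝ Z']
    {Ψ : Z → EReal} {B : Z →ₗ[ℝ] Z'}
    {v : Z} {a : ℝ} (ha : Ψ v = a) (z : Z) :
    (⨅ v' : Z, (Ψ v' + ((1 / 2 * ‖B (z - v')‖ ^ 2 : ℝ) : EReal)))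
      ≤ ((a + 1 / 2 * ‖B (z - v)‖ ^ 2 : ℝ) : EReal) := by
  refine (iInf_le _ v).trans ?_
  rw [ha, ← EReal.coe_add]

theorem envelope_eq
    {Z Z' : Type*}
    [NormedAddCommGroup Z] [InnerProductSpace ℝ Z] [FiniteDimensional ℝ Z]
    [NormedAddCommGroup Z'] [InnerProductSpace ℝ Z'] [FiniteDimensional ℝ Z']
    {Ψ : Z → EReal} {B : Z →ₗ[ℝ] Z'}
    {v z : Z} (hv : LinearMap.adjoint B (B (z - v)) ∈ esubdiff Ψ v)
    {a : ℝ} (ha : Ψ v = a) :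
    (⨅ v' : Z, (Ψ v' + ((1 / 2 * ‖B (z - v')‖ ^ 2 : ℝ) : EReal)))
      = ((a + 1 / 2 * ‖B (z - v)‖ ^ 2 : ℝ) : EReal) :=
  le_antisymm (envelope_le ha z) (by simpa using envelope_tangent_le hv ha z)

theorem Jcost_eq_top {X Y Z Z' : Type*}
    [NormedAddCommGroup X] [InnerProductSpace ℝ X]
    [NormedAddCommGroup Y] [InnerProductSpace ℝ Y]
    [NormedAddCommGroup Z] [InnerProductSpace ℝ Z]
    [NormedAddCommGroup Z'] [InnerProductSpace ℝ Z']
    {A : X →ₗ[ℝ] Y} {Lm : X →ₗ[ℝ] Z} {B : Z →ₗ[ℝ] Z'} {f : Y → ℝ} {Ψ : Z → EReal} {μ : ℝ}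
    (hμ : 0 < μ) {x : X} (hx : Ψ (Lm x) = ⊤) {e : ℝ}
    (he : (⨅ v : Z, (Ψ v + ((1 / 2 * ‖B (Lm x - v)‖ ^ 2 : ℝ) : EReal))) = e) :
    Jcost A Lm B f Ψ μ x = ⊤ := by
  rw [Jcost, GME, he, hx, EReal.top_sub_coe, EReal.coe_mul_top_of_pos hμ, EReal.coe_add_top]

theorem Jcost_eq_coe {X Y Z Z' : Type*}
    [NormedAddCommGroup X] [InnerProductSpace ℝ X]
    [NormedAddCommGroup Y] [InnerProductSpace ℝ Y]
    [NormedAddCommGroup Z] [InnerProductSpace ℝ Z]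
    [NormedAddCommGroup Z'] [InnerProductSpace ℝ Z']
    {A : X →ₗ[ℝ] Y} {Lm : X →ₗ[ℝ] Z} {B : Z →ₗ[ℝ] Z'} {f : Y → ℝ} {Ψ : Z → EReal} {μ : ℝ}
    {x : X} {b : ℝ} (hx : Ψ (Lm x) = b) {e : ℝ}
    (he : (⨅ v : Z, (Ψ v + ((1 / 2 * ‖B (Lm x - v)‖ ^ 2 : ℝ) : EReal))) = e) :
    Jcost A Lm B f Ψ μ x = ((f (A x) + μ * (b - e) : ℝ) : EReal) := by
  rw [Jcost, GME, he, hx, ← EReal.coe_sub, ← EReal.coe_mul, ← EReal.coe_add]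

theorem stmt16
    {X Y Z Z' W : Type*}
    [NormedAddCommGroup X] [InnerProductSpace ℝ X] [FiniteDimensional ℝ X]
    [NormedAddCommGroup Y] [InnerProductSpace ℝ Y] [FiniteDimensional ℝ Y]
    [NormedAddCommGroup Z] [InnerProductSpace ℝ Z] [FiniteDimensional ℝ Z]
    [NormedAddCommGroup Z'] [InnerProductSpace ℝ Z'] [FiniteDimensional ℝ Z']
    [NormedAddCommGroup W] [InnerProductSpace ℝ W] [FiniteDimensional ℝ W]
    (A : X →ₗ[ℝ] Y) (Lm : X →ₗ[ℝ] Z) (B : Z →ₗ[ℝ] Z') (Cm : X →ₗ[ℝ] W)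
    (f : Y → ℝ) (hf : ConvexOn ℝ Set.univ f)
    (Ψ : Z → EReal) (hΨbot : ∀ z : Z, Ψ z ≠ ⊥) (hΨlsc : LowerSemicontinuous Ψ)
    (hΨconv : EConvex Ψ) (hΨcoer : ECoercive Ψ)
    (μ : ℝ) (hμ : 0 < μ)
    (Δ : Set W) (hΔne : Δ.Nonempty) (hΔcl : IsClosed Δ) (hΔcv : Convex ℝ Δ)
    (hfeas : ∃ x : X, Ψ (Lm x) ≠ ⊤ ∧ Cm x ∈ Δ)
    (hC1 : ConvexOn ℝ Set.univ (fun x : X => f (A x) - μ / 2 * ‖B (Lm x)‖ ^ 2))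
    (hfdiff : Differentiable ℝ f) (Lf : ℝ) (hLf : 0 < Lf)
    (hflip : ∀ y₁ y₂ : Y, ‖gradient f y₁ - gradient f y₂‖ ≤ Lf * ‖y₁ - y₂‖)
    (hsum : ∀ x : X,
      esubdiff (fun x' : X => Jcost A Lm B f Ψ μ x' + eindicator Δ (Cm x')) x
        = esubdiff (Jcost A Lm B f Ψ μ) x
          + esubdiff (fun x' : X => eindicator Δ (Cm x')) x)
    (hchainΨ : ∀ x : X,
      esubdiff (fun x' : X => Ψ (Lm x')) x = LinearMap.adjoint Lm '' esubdiff Ψ (Lm x))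
    (hchainΔ : ∀ x : X,
      esubdiff (fun x' : X => eindicator Δ (Cm x')) x
        = LinearMap.adjoint Cm '' esubdiff (eindicator Δ) (Cm x)) :
    ∀ xs : X,
      (Cm xs ∈ Δ ∧ ∀ x : X, Cm x ∈ Δ → Jcost A Lm B f Ψ μ xs ≤ Jcost A Lm B f Ψ μ x)
        ↔ ∃ (v w : Z) (z : W),
            (0 : X) = gradient (fun x : X => f (A x) - μ / 2 * ‖B (Lm x)‖ ^ 2) xs
                + μ • (LinearMap.adjoint Lm) ((LinearMap.adjoint B) (B v))
                + μ • (LinearMap.adjoint Lm) w + μ • (LinearMap.adjoint Cm) z ∧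
            (LinearMap.adjoint B) (B (Lm xs))
                ∈ esubdiff Ψ v + ({(LinearMap.adjoint B) (B v)} : Set Z) ∧
            w ∈ esubdiff Ψ (Lm xs) ∧
            z ∈ esubdiff (eindicator Δ) (Cm xs) := by
  intro xs
  obtain ⟨x₀, hx₀, hx₀Δ⟩ := hfeas
  have hprox : ∀ z : Z, ∃ (v : Z) (a : ℝ), Ψ v = a ∧
      LinearMap.adjoint B (B (z - v)) ∈ esubdiff Ψ v := fun z => by
    obtain ⟨v, hv⟩ := exists_proximal_point (B := B) hΨbot hΨlsc hΨconv hΨcoer hx₀ z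
    exact ⟨v, _, (EReal.coe_toReal (ne_top_of_mem_esubdiff hv hx₀) (hΨbot v)).symm, hv⟩
  have henv : ∀ z : Z, ∃ e : ℝ,
      (⨅ v : Z, (Ψ v + ((1 / 2 * ‖B (z - v)‖ ^ 2 : ℝ) : EReal))) = e := fun z => by
    obtain ⟨v, a, ha, hv⟩ := hprox z
    exact ⟨_, envelope_eq hv ha⟩
  have hreal : ∀ z : Z, Ψ z ≠ ⊤ → ∃ b : ℝ, Ψ z = b := fun z hz =>
    ⟨_, (EReal.coe_toReal hz (hΨbot z)).symm⟩
  set d : X → ℝ := fun x : X => f (A x) - μ / 2 * ‖B (Lm x)‖ ^ 2 with hd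
  have hdiff : DifferentiableAt ℝ d xs := by
    have hA : Differentiable ℝ A := A.toContinuousLinearMap.differentiable
    have hBL : Differentiable ℝ fun x => B (Lm x) :=
      (B ∘ₗ Lm).toContinuousLinearMap.differentiable
    exact ((hfdiff.comp hA).sub ((hBL.norm_sq ℝ).const_mul (μ / 2))) xs
  have hgrad : HasGradientAt d (gradient d xs) xs := hdiff.hasGradientAt
  have hfd : ∀ x, f (A x) = d x + μ / 2 * ‖B (Lm x)‖ ^ 2 := fun x => by simp [hd]
  constructor
  · rintro ⟨hxs, hmin⟩
    have hJbot : ∀ x, Jcost A Lm B f Ψ μ x ≠ ⊥ := fun x => by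
      obtain ⟨e, he⟩ := henv (Lm x)
      by_cases hx : Ψ (Lm x) = ⊤
      · simp [Jcost_eq_top hμ hx he]
      · obtain ⟨b, hb⟩ := hreal _ hx
        rw [Jcost_eq_coe hb he]
        exact EReal.coe_ne_bot _
    have h0 : (0 : X) ∈
        esubdiff (fun x' : X => Jcost A Lm B f Ψ μ x' + eindicator Δ (Cm x')) xs := by
      intro y
      by_cases hy : Cm y ∈ Δ
      · simpa [eindicator, hxs, hy] using hmin y hy
      · simp [eindicator, hy, EReal.add_top_of_ne_bot (hJbot y)]
    rw [hsum, hchainΔ] at h0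
    obtain ⟨p, hp, _, ⟨z₀, hz₀, rfl⟩, hpz⟩ := h0
    obtain ⟨v, a, ha, hv⟩ := hprox (Lm xs)
    have hes := envelope_eq hv ha
    have hxst : Ψ (Lm xs) ≠ ⊤ := fun h => by
      obtain ⟨b, hb⟩ := hreal _ hx₀
      obtain ⟨e, he⟩ := henv (Lm x₀)
      refine ne_top_of_mem_esubdiff (y := x₀) hp ?_ (Jcost_eq_top hμ h hes)
      rw [Jcost_eq_coe hb he]
      exact EReal.coe_ne_top _
    obtain ⟨b, hb⟩ := hreal _ hxst
    have hw : (μ⁻¹ • p - Lm.adjoint (B.adjoint (B v))) - μ⁻¹ • gradient d xs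
        ∈ esubdiff (fun x' : X => Ψ (Lm x')) xs := by
      refine sub_smul_mem_esubdiff (c := 1 / 2) (M := B ∘ₗ Lm) (fun y => hΨbot _)
        (hΨconv.comp_linearMap Lm) hgrad hb fun y b' hb' => ?_
      obtain ⟨e, he⟩ := henv (Lm y)
      have htan := envelope_tangent_le hv ha (Lm y)
      rw [he, EReal.coe_le_coe_iff] at htan
      have hJ := hp y
      rw [Jcost_eq_coe hb hes, Jcost_eq_coe hb' he, ← EReal.coe_add, EReal.coe_le_coe_iff,
        hfd, hfd] at hJ
      rw [inner_sub_right, inner_smul_right, LinearMap.adjoint_inner_right,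
        LinearMap.adjoint_inner_right, LinearMap.comp_apply]
      have hy : B (Lm y) = B (Lm xs) + B (Lm (y - xs)) := by simp
      have hyx : B (Lm y - Lm xs) = B (Lm (y - xs)) := by simp
      rw [hyx, map_sub B (Lm xs) v, inner_sub_right] at htan
      rw [hy, norm_add_sq_real, map_sub B (Lm xs) v,
        real_inner_comm (B (Lm (y - xs))) (B (Lm xs))] at hJ
      refine le_of_mul_le_mul_left ?_ hμ
      have hμe := mul_le_mul_of_nonneg_left htan hμ.le
      have hμ' : ∀ r : ℝ, μ * (μ⁻¹ * r) = r := fun r => by field_simp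
      simp only [mul_add, mul_sub, hμ'] at hJ hμe ⊢
      linarith
    rw [hchainΨ] at hw
    obtain ⟨w, hw, hweq⟩ := hw
    rw [mem_esubdiff_eindicator_iff hΔne] at hz₀
    refine ⟨v, w, μ⁻¹ • z₀, ?_, ?_, hw, ?_⟩
    · rw [hweq, map_smul, smul_inv_smul₀ hμ.ne', smul_sub, smul_sub, smul_inv_smul₀ hμ.ne',
        smul_inv_smul₀ hμ.ne', ← hpz]
      simp only
      abel
    · refine Set.mem_add.2 ⟨_, hv, _, rfl, ?_⟩
      simp
    · refine (mem_esubdiff_eindicator_iff hΔne).2 ⟨hxs, fun q hq => ?_⟩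
      rw [inner_smul_right]
      exact mul_nonpos_of_nonneg_of_nonpos (inv_nonneg.2 hμ.le) (hz₀.2 q hq)
  · rintro ⟨v, w, z, heq, hv, hw, hz⟩
    rw [mem_esubdiff_eindicator_iff hΔne] at hz
    refine ⟨hz.1, fun x hx => ?_⟩
    have hv' : LinearMap.adjoint B (B (Lm xs - v)) ∈ esubdiff Ψ v := by
      obtain ⟨u, hu, _, rfl, huv⟩ := Set.mem_add.1 hv
      rwa [map_sub, map_sub, ← huv, add_sub_cancel_right]
    obtain ⟨a, ha⟩ := hreal _ (ne_top_of_mem_esubdiff hv' hx₀)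
    obtain ⟨b, hb⟩ := hreal _ (ne_top_of_mem_esubdiff hw hx₀)
    obtain ⟨e, he⟩ := henv (Lm x)
    by_cases hxt : Ψ (Lm x) = ⊤
    · rw [Jcost_eq_top hμ hxt he]
      exact le_top
    obtain ⟨b', hb'⟩ := hreal _ hxt
    rw [Jcost_eq_coe hb (envelope_eq hv' ha), Jcost_eq_coe hb' he, EReal.coe_le_coe_iff, hfd, hfd]
    have hup := envelope_le (B := B) ha (Lm x)
    rw [he, EReal.coe_le_coe_iff] at hup
    have hd' := hC1.gradient_mem_esubdiff hgrad x
    rw [← EReal.coe_add, EReal.coe_le_coe_iff] at hd'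
    have hw' := hw (Lm x)
    rw [hb, hb', ← EReal.coe_add, EReal.coe_le_coe_iff] at hw'
    have hz' := hz.2 _ hx
    have hip := congrArg (fun u => ⟪x - xs, u⟫) heq
    simp only [inner_zero_right, inner_add_right, inner_smul_right,
      LinearMap.adjoint_inner_right] at hip
    rw [← map_sub] at hw' hz'
    have hBx : B (Lm x) = B (Lm xs) + B (Lm (x - xs)) := by simp
    rw [map_sub B (Lm x) v, hBx, add_sub_right_comm, norm_add_sq_real, inner_sub_left,
      real_inner_comm (B (Lm (x - xs))) (B v)] at hup
    rw [hBx, norm_add_sq_real, map_sub B (Lm xs) v]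
    have h1 := mul_le_mul_of_nonneg_left hup hμ.le
    have h2 := mul_le_mul_of_nonneg_left hw' hμ.le
    have h3 := mul_le_mul_of_nonneg_left hz' hμ.le
    simp only [mul_add, mul_sub] at h1 h2 h3 hip ⊢
    linarith
end
end
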